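/- Let b be a slowly varying function and p, q ∈ (0,∞]. Suppose that either (a) 1 ≤ q < p, or (b) 1 ≤ q = p and there exist constants K, t₀ > 0 such that b(t) ≥ K for all t ∈ (0, t₀). Then ‖·‖_{p,q,b} satisfies property (P5): for every E ⊆ R with μ(E) < ∞ there is a finite constant C_E such that ∫_E |f| dμ ≤ C_E ‖f‖_{p,q,b} for all μ-measurable f. -/

import Mathlib

open MeasureTheory Set Filter ENNReal Topology

noncomputable section

/-- `f ≈ g` on `S`: two-sided equivalence with positive constants. -/
def EquivOn (f g : ℝ → ℝ) (S : Set ℝ) : Prop :=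
  ∃ c C : ℝ, 0 < c ∧ 0 < C ∧ ∀ t ∈ S, c * g t ≤ f t ∧ f t ≤ C * g t

/-- A measurable positive function on `(0,∞)` is slowly varying if for every `ε > 0`,
`t ^ ε * b t` is equivalent to a non-decreasing function and `t ^ (-ε) * b t` is
equivalent to a non-increasing function on `(0,∞)`. -/
def IsSlowlyVarying (b : ℝ → ℝ) : Prop :=
  Measurable b ∧ (∀ t ∈ Set.Ioi (0:ℝ), 0 < b t) ∧
    ∀ ε : ℝ, 0 < ε →
      (∃ bp : ℝ → ℝ, MonotoneOn bp (Set.Ioi 0) ∧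
        EquivOn (fun t => t ^ ε * b t) bp (Set.Ioi 0)) ∧
      (∃ bm : ℝ → ℝ, AntitoneOn bm (Set.Ioi 0) ∧
        EquivOn (fun t => t ^ (-ε) * b t) bm (Set.Ioi 0))

/-- The non-increasing rearrangement `f*` (with values in `ℝ≥0∞`). -/
def rearr {X : Type*} [MeasurableSpace X] (μ : Measure X) (f : X → ℝ) (t : ℝ) : ℝ≥0∞ :=
  sInf {s : ℝ≥0∞ | μ {x | s < ENNReal.ofReal |f x|} ≤ ENNReal.ofReal t}

/-- The maximal function `f**(t) = (1/t) ∫₀ᵗ f*`. -/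
def maxf {X : Type*} [MeasurableSpace X] (μ : Measure X) (f : X → ℝ) (t : ℝ) : ℝ≥0∞ :=
  (ENNReal.ofReal t)⁻¹ * ∫⁻ s in Set.Ioo (0:ℝ) t, rearr μ f s

/-- The `L^q` "norm" over a subset `S ⊆ ℝ` of an `ℝ≥0∞`-valued function. -/
def lqNorm (q : ℝ≥0∞) (S : Set ℝ) (g : ℝ → ℝ≥0∞) : ℝ≥0∞ :=
  if q = ∞ then essSup g (volume.restrict S)
  else (∫⁻ t in S, g t ^ q.toReal) ^ (1 / q.toReal)

/-- The Lorentz–Karamata functional `‖f‖_{p,q,b}`. -/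
def lkNorm {X : Type*} [MeasurableSpace X] (μ : Measure X) (p q : ℝ≥0∞) (b : ℝ → ℝ)
    (f : X → ℝ) : ℝ≥0∞ :=
  lqNorm q (Set.Ioi 0)
    (fun t => ENNReal.ofReal (t ^ (p⁻¹.toReal - q⁻¹.toReal) * b t) * rearr μ f t)

/-- The Lorentz–Karamata functional `‖f‖_{(p,q,b)}` defined via the maximal function. -/
def lkMaxNorm {X : Type*} [MeasurableSpace X] (μ : Measure X) (p q : ℝ≥0∞) (b : ℝ → ℝ)
    (f : X → ℝ) : ℝ≥0∞ :=
  lqNorm q (Set.Ioi 0)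
    (fun t => ENNReal.ofReal (t ^ (p⁻¹.toReal - q⁻¹.toReal) * b t) * maxf μ f t)

/-- The `L^q(0,∞)` norm of `t ^ (1/p - 1/q) * b t` restricted to `S`. -/
def weightNorm (p q : ℝ≥0∞) (b : ℝ → ℝ) (S : Set ℝ) : ℝ≥0∞ :=
  lqNorm q S (fun t => ENNReal.ofReal (t ^ (p⁻¹.toReal - q⁻¹.toReal) * b t))

/-- A measure is non-atomic. -/
def IsNonatomic {X : Type*} [MeasurableSpace X] (μ : Measure X) : Prop :=
  ∀ s : Set X, MeasurableSet s → 0 < μ s →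
    ∃ t, t ⊆ s ∧ MeasurableSet t ∧ 0 < μ t ∧ μ t < μ s

/-- `b̃(t) = ∫₀ᵗ s⁻¹ b(s) ds`. -/
def svTilde (b : ℝ → ℝ) (t : ℝ) : ℝ≥0∞ :=
  ∫⁻ s in Set.Ioo (0:ℝ) t, ENNReal.ofReal (s⁻¹ * b s)

/-- `b̃_∞(t) = esssup_{s ∈ (0,t)} b(s)`. -/
def svTildeSup (b : ℝ → ℝ) (t : ℝ) : ℝ≥0∞ :=
  essSup (fun s => ENNReal.ofReal (b s)) (volume.restrict (Set.Ioo (0:ℝ) t))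

/-- `b̂(t) = ∫_t^∞ s⁻¹ b(s) ds`. -/
def svHat (b : ℝ → ℝ) (t : ℝ) : ℝ≥0∞ :=
  ∫⁻ s in Set.Ioi t, ENNReal.ofReal (s⁻¹ * b s)

/-- `b̂_∞(t) = esssup_{s ∈ (t,∞)} b(s)`. -/
def svHatSup (b : ℝ → ℝ) (t : ℝ) : ℝ≥0∞ :=
  essSup (fun s => ENNReal.ofReal (b s)) (volume.restrict (Set.Ioi t))

/-- The associate functional of a functional `N`. -/
def assocNorm {X : Type*} [MeasurableSpace X] (μ : Measure X) (N : (X → ℝ) → ℝ≥0∞)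
    (f : X → ℝ) : ℝ≥0∞ :=
  ⨆ (g : X → ℝ) (_ : Measurable g) (_ : N g ≤ 1), ∫⁻ x, ENNReal.ofReal |f x * g x| ∂μ

/-- The conjugate exponent: `q' = q/(q-1)` for `q ∈ (1,∞)`, `1' = ∞`, `∞' = 1`. -/
def conjE (q : ℝ≥0∞) : ℝ≥0∞ := (1 - q⁻¹)⁻¹

/-- The interval `(0, μ(R))` inside `ℝ`, where `μ(R)` may be infinite. -/
def IooMu {X : Type*} [MeasurableSpace X] (μ : Measure X) : Set ℝ :=
  {t : ℝ | 0 < t ∧ ENNReal.ofReal t < μ Set.univ}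

/-- The embedding `L^{p₁,q₁,b₁} ↪ L^{p₂,q₂,b₂}`. -/
def lkEmbed {X : Type*} [MeasurableSpace X] (μ : Measure X) (p1 q1 : ℝ≥0∞) (b1 : ℝ → ℝ)
    (p2 q2 : ℝ≥0∞) (b2 : ℝ → ℝ) : Prop :=
  ∃ C : ℝ≥0∞, C < ∞ ∧ ∀ f : X → ℝ, Measurable f →
    lkNorm μ p2 q2 b2 f ≤ C * lkNorm μ p1 q1 b1 f

/-- A rearrangement-invariant quasi-Banach function norm. -/
structure IsRIQuasiBFN {X : Type*} [MeasurableSpace X] (μ : Measure X)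
    (N : (X → ℝ) → ℝ≥0∞) : Prop where
  abs_eq : ∀ f : X → ℝ, Measurable f → N (fun x => |f x|) = N f
  smul : ∀ (a : ℝ) (f : X → ℝ), Measurable f →
    N (fun x => a * f x) = ENNReal.ofReal |a| * N f
  eq_zero_iff : ∀ f : X → ℝ, Measurable f → (N f = 0 ↔ f =ᵐ[μ] 0)
  quasi_add : ∃ C : ℝ≥0∞, C < ∞ ∧ ∀ f g : X → ℝ, Measurable f → Measurable g →
    N (fun x => f x + g x) ≤ C * (N f + N g)
  mono : ∀ f g : X → ℝ, Measurable f → Measurable g →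
    (∀ᵐ x ∂μ, |f x| ≤ |g x|) → N f ≤ N g
  fatou : ∀ (f : ℕ → X → ℝ) (g : X → ℝ), (∀ n, Measurable (f n)) → Measurable g →
    (∀ᵐ x ∂μ, ∀ n, 0 ≤ f n x) → (∀ᵐ x ∂μ, Monotone fun n => f n x) →
    (∀ᵐ x ∂μ, Filter.Tendsto (fun n => f n x) Filter.atTop (nhds (g x))) →
    N g = ⨆ n, N (f n)
  ind_lt_top : ∀ E : Set X, MeasurableSet E → μ E < ∞ →
    N (Set.indicator E fun _ => (1:ℝ)) < ∞
  rearr_inv : ∀ f g : X → ℝ, Measurable f → Measurable g →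
    rearr μ f = rearr μ g → N f = N g

/-- A rearrangement-invariant Banach function norm. -/
structure IsRIBFN {X : Type*} [MeasurableSpace X] (μ : Measure X)
    (N : (X → ℝ) → ℝ≥0∞) : Prop where
  abs_eq : ∀ f : X → ℝ, Measurable f → N (fun x => |f x|) = N f
  smul : ∀ (a : ℝ) (f : X → ℝ), Measurable f →
    N (fun x => a * f x) = ENNReal.ofReal |a| * N f
  eq_zero_iff : ∀ f : X → ℝ, Measurable f → (N f = 0 ↔ f =ᵐ[μ] 0)
  add_le : ∀ f g : X → ℝ, Measurable f → Measurable g →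
    N (fun x => f x + g x) ≤ N f + N g
  mono : ∀ f g : X → ℝ, Measurable f → Measurable g →
    (∀ᵐ x ∂μ, |f x| ≤ |g x|) → N f ≤ N g
  fatou : ∀ (f : ℕ → X → ℝ) (g : X → ℝ), (∀ n, Measurable (f n)) → Measurable g →
    (∀ᵐ x ∂μ, ∀ n, 0 ≤ f n x) → (∀ᵐ x ∂μ, Monotone fun n => f n x) →
    (∀ᵐ x ∂μ, Filter.Tendsto (fun n => f n x) Filter.atTop (nhds (g x))) →
    N g = ⨆ n, N (f n)
  ind_lt_top : ∀ E : Set X, MeasurableSet E → μ E < ∞ →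
    N (Set.indicator E fun _ => (1:ℝ)) < ∞
  integral_le : ∀ E : Set X, MeasurableSet E → μ E < ∞ →
    ∃ C : ℝ≥0∞, C < ∞ ∧ ∀ f : X → ℝ, Measurable f →
      ∫⁻ x in E, ENNReal.ofReal |f x| ∂μ ≤ C * N f
  rearr_inv : ∀ f g : X → ℝ, Measurable f → Measurable g →
    rearr μ f = rearr μ g → N f = N g

end

/-- On a bounded interval a slowly varying function times a negative power is bounded below. -/
theorem IsSlowlyVarying.exists_le_rpow_neg_mul {b : ℝ → ℝ} (hb : IsSlowlyVarying b) {ε : ℝ}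
    (hε : 0 < ε) {T : ℝ} (hT : 0 < T) :
    ∃ k : ℝ, 0 < k ∧ ∀ t ∈ Set.Ioc (0:ℝ) T, k ≤ t ^ (-ε) * b t := by
  obtain ⟨-, hpos, hsv⟩ := hb
  obtain ⟨-, bm, hanti, c, C, hc, hC, hbm⟩ := hsv ε hε
  have hbmT : 0 < bm T := by
    have h1 : 0 < T ^ (-ε) * b T := mul_pos (Real.rpow_pos_of_pos hT _) (hpos T hT)
    exact pos_of_mul_pos_right (h1.trans_le (hbm T hT).2) hC.le
  refine ⟨c * bm T, mul_pos hc hbmT, fun t ht => ?_⟩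
  exact (mul_le_mul_of_nonneg_left (hanti ht.1 hT ht.2) hc.le).trans (hbm t ht.1).1

theorem rearr_antitone {X : Type*} [MeasurableSpace X] (μ : Measure X) (f : X → ℝ) :
    Antitone (rearr μ f) := fun _ _ h =>
  sInf_le_sInf fun _ hu => le_trans hu (ENNReal.ofReal_le_ofReal h)

theorem le_rearr {X : Type*} [MeasurableSpace X] {μ : Measure X} {f : X → ℝ} {s : ℝ≥0∞} {t : ℝ}
    (h : ENNReal.ofReal t < μ {x | s < ENNReal.ofReal |f x|}) : s ≤ rearr μ f t := by
  refine le_sInf fun u hu => ?_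
  by_contra! hus
  exact absurd (h.trans_le (measure_mono fun x hx => hus.trans hx)) (not_lt.2 hu)

/-- A set of finite measure `E` sees at most the mass of `f*` on `(0, μ E)`. -/
theorem setLIntegral_le_lintegral_rearr {X : Type*} [MeasurableSpace X] (μ : Measure X)
    {E : Set X} (hEfin : μ E ≠ ∞) {f : X → ℝ} (hf : Measurable f) :
    ∫⁻ x in E, ENNReal.ofReal |f x| ∂μ ≤ ∫⁻ t in Set.Ioo 0 (μ E).toReal, rearr μ f t := by
  have hr : Measurable (rearr μ f) := (rearr_antitone μ f).measurable
  set ν : Measure ℝ := volume.restrict (Set.Ioo 0 (μ E).toReal)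
  have hmeas : MeasurableSet {z : ℝ × ℝ | ENNReal.ofReal z.1 ≤ rearr μ f z.2} :=
    measurableSet_le (ENNReal.measurable_ofReal.comp measurable_fst) (hr.comp measurable_snd)
  have key (s : ℝ) (hs : 0 < s) :
      μ.restrict E {x | s < |f x|} ≤ ν {t | ENNReal.ofReal s ≤ rearr μ f t} := by
    have hle : μ.restrict E {x | s < |f x|} ≤ μ E :=
      (measure_mono (subset_univ _)).trans (by simp)
    have hne : μ.restrict E {x | s < |f x|} ≠ ∞ := ne_top_of_le_ne_top hEfin hle
    have hsub : Set.Ioo 0 (μ.restrict E {x | s < |f x|}).toReal ⊆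
        {t | ENNReal.ofReal s ≤ rearr μ f t} ∩ Set.Ioo 0 (μ E).toReal := by
      intro t ht
      refine ⟨le_rearr ?_, ht.1, ht.2.trans_le (ENNReal.toReal_mono hEfin hle)⟩
      refine ((ENNReal.ofReal_lt_iff_lt_toReal ht.1.le hne).2 ht.2).trans_le ?_
      refine (Measure.restrict_apply_le _ _).trans (measure_mono fun x hx => ?_)
      exact (ENNReal.ofReal_lt_ofReal_iff_of_nonneg hs.le).2 hx
    rw [Measure.restrict_apply (measurableSet_le measurable_const hr)]
    refine le_trans ?_ (measure_mono hsub)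
    rw [Real.volume_Ioo, sub_zero, ENNReal.ofReal_toReal hne]
  calc ∫⁻ x in E, ENNReal.ofReal |f x| ∂μ
      = ∫⁻ s in Set.Ioi (0:ℝ), μ.restrict E {x | s < |f x|} :=
        lintegral_eq_lintegral_meas_lt _ (Eventually.of_forall fun x => abs_nonneg _)
          hf.abs.aemeasurable
    _ ≤ ∫⁻ s in Set.Ioi (0:ℝ), ν {t | ENNReal.ofReal s ≤ rearr μ f t} :=
        setLIntegral_mono' measurableSet_Ioi key
    _ = ((volume.restrict (Set.Ioi (0:ℝ))).prod ν)
          {z : ℝ × ℝ | ENNReal.ofReal z.1 ≤ rearr μ f z.2} := (Measure.prod_apply hmeas).symm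
    _ = ∫⁻ t, volume.restrict (Set.Ioi (0:ℝ)) {s | ENNReal.ofReal s ≤ rearr μ f t} ∂ν :=
        Measure.prod_apply_symm hmeas
    _ ≤ ∫⁻ t, rearr μ f t ∂ν := by
        refine lintegral_mono fun t => ?_
        rcases eq_or_ne (rearr μ f t) ∞ with h | h
        · simp [h]
        · rw [Measure.restrict_apply (measurableSet_le ENNReal.measurable_ofReal measurable_const)]
          calc _ ≤ volume (Set.Ioc 0 (rearr μ f t).toReal) :=
                measure_mono fun s hs => ⟨hs.2, (ENNReal.ofReal_le_iff_le_toReal h).1 hs.1⟩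
            _ = rearr μ f t := by rw [Real.volume_Ioc, sub_zero, ENNReal.ofReal_toReal h]

theorem lqNorm_eq_eLpNorm {q : ℝ≥0∞} (hq : q ≠ 0) (S : Set ℝ) (g : ℝ → ℝ≥0∞) :
    lqNorm q S g = eLpNorm g q (volume.restrict S) := by
  unfold lqNorm
  split_ifs with h
  · simp [h, eLpNormEssSup]
  · simp [eLpNorm_eq_lintegral_rpow_enorm_toReal hq h]

/-- If the weight is bounded below near `0`, then `‖·‖_{p,q,b}` controls `∫_0^T f*`. -/
theorem lintegral_rearr_le_lkNorm {X : Type*} [MeasurableSpace X] (μ : Measure X)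
    {p q : ℝ≥0∞} (hq : 1 ≤ q) {b : ℝ → ℝ} {k T : ℝ} (hk : 0 < k)
    (hkb : ∀ t ∈ Set.Ioo (0:ℝ) T, k ≤ t ^ (p⁻¹.toReal - q⁻¹.toReal) * b t) (f : X → ℝ) :
    ∫⁻ t in Set.Ioo 0 T, rearr μ f t ≤
      ENNReal.ofReal T ^ (1 - 1 / q.toReal) * ENNReal.ofReal k⁻¹ * lkNorm μ p q b f := by
  have hr : Measurable (rearr μ f) := (rearr_antitone μ f).measurable
  have holder := eLpNorm_le_eLpNorm_mul_rpow_measure_univ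
    (μ := volume.restrict (Set.Ioo 0 T)) hq hr.aestronglyMeasurable
  rw [eLpNorm_one_eq_lintegral_enorm] at holder
  simp only [enorm_eq_self, Measure.restrict_apply MeasurableSet.univ, Set.univ_inter,
    Real.volume_Ioo, sub_zero, ENNReal.toReal_one, div_one] at holder
  have hweight : eLpNorm (rearr μ f) q (volume.restrict (Set.Ioo 0 T)) ≤
      ENNReal.ofReal k⁻¹ * lkNorm μ p q b f := by
    rw [lkNorm, lqNorm_eq_eLpNorm (zero_lt_one.trans_le hq).ne']
    refine le_trans (eLpNorm_le_mul_eLpNorm_of_ae_le_mul' (c := k⁻¹.toNNReal) ?_ q)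
      (mul_le_mul_right (eLpNorm_mono_measure _
        (Measure.restrict_mono Set.Ioo_subset_Ioi_self le_rfl)) _)
    filter_upwards [ae_restrict_mem measurableSet_Ioo] with t ht
    simp only [enorm_eq_self]
    change _ ≤ ENNReal.ofReal k⁻¹ * _
    rw [← mul_assoc, ← ENNReal.ofReal_mul (inv_nonneg.2 hk.le)]
    refine le_mul_of_one_le_left' (ENNReal.one_le_ofReal.2 ?_)
    rw [← div_eq_inv_mul, one_le_div hk]
    exact hkb t ht
  calc _ ≤ _ := holder
    _ ≤ ENNReal.ofReal k⁻¹ * lkNorm μ p q b f * ENNReal.ofReal T ^ (1 - 1 / q.toReal) := by gcongr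
    _ = _ := by ring

/-- Proposition LP5, part (i): sufficient conditions for `‖·‖_{p,q,b}`
to satisfy property (P5). -/
theorem lkNorm_P5_of {X : Type*} [MeasurableSpace X] (μ : Measure X)
    [SigmaFinite μ] (hna : IsNonatomic μ) (hμ : μ Set.univ = ∞)
    (p q : ℝ≥0∞) (hp : 0 < p) (hq : 0 < q) (b : ℝ → ℝ) (hb : IsSlowlyVarying b)
    (hpq : (1 ≤ q ∧ q < p) ∨
      (1 ≤ q ∧ q = p ∧ ∃ K t0 : ℝ, 0 < K ∧ 0 < t0 ∧ ∀ t ∈ Set.Ioo (0:ℝ) t0, K ≤ b t)) :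
    ∀ E : Set X, MeasurableSet E → μ E < ∞ → ∃ C : ℝ≥0∞, C < ∞ ∧
      ∀ f : X → ℝ, Measurable f →
        ∫⁻ x in E, ENNReal.ofReal |f x| ∂μ ≤ C * lkNorm μ p q b f := by
  intro E _ hEfin
  have hq1 : 1 ≤ q := hpq.elim And.left And.left
  have hqinv : q⁻¹ ≠ ∞ := ENNReal.inv_ne_top.2 hq.ne'
  obtain ⟨k, hk, hkb⟩ : ∃ k : ℝ, 0 < k ∧ ∀ t ∈ Set.Ioo (0:ℝ) (μ E).toReal,
      k ≤ t ^ (p⁻¹.toReal - q⁻¹.toReal) * b t := by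
    have hT : 0 < (μ E).toReal + 1 := by positivity
    have hIoc {t : ℝ} (ht : t ∈ Set.Ioo (0:ℝ) (μ E).toReal) :
        t ∈ Set.Ioc (0:ℝ) ((μ E).toReal + 1) := ⟨ht.1, by linarith [ht.2]⟩
    rcases hpq with ⟨-, hlt⟩ | ⟨-, rfl, K, t0, hK, ht0, hKb⟩
    · have hε : 0 < q⁻¹.toReal - p⁻¹.toReal :=
        sub_pos.2 (ENNReal.toReal_strict_mono hqinv (ENNReal.inv_lt_inv.2 hlt))
      obtain ⟨k, hk, h⟩ := hb.exists_le_rpow_neg_mul hε hT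
      refine ⟨k, hk, fun t ht => ?_⟩
      simpa only [neg_sub] using h t (hIoc ht)
    · obtain ⟨k, hk, h⟩ := hb.exists_le_rpow_neg_mul one_pos hT
      refine ⟨min K (k * t0), lt_min hK (mul_pos hk ht0), fun t ht => ?_⟩
      rw [sub_self, Real.rpow_zero, one_mul]
      rcases lt_or_ge t t0 with htt | htt
      · exact (min_le_left _ _).trans (hKb t ⟨ht.1, htt⟩)
      · have h1 := h t (hIoc ht)
        rw [Real.rpow_neg_one, ← div_eq_inv_mul, le_div_iff₀ ht.1] at h1
        exact (min_le_right _ _).trans ((mul_le_mul_of_nonneg_left htt hk.le).trans h1)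
  have hexp : 0 ≤ 1 - 1 / q.toReal := by
    rcases eq_or_ne q ∞ with rfl | hqt
    · simp
    · have h1 : 1 ≤ q.toReal := by simpa using ENNReal.toReal_mono hqt hq1
      exact sub_nonneg.2 ((div_le_one (by linarith)).2 h1)
  refine ⟨ENNReal.ofReal (μ E).toReal ^ (1 - 1 / q.toReal) * ENNReal.ofReal k⁻¹,
    ENNReal.mul_lt_top (ENNReal.rpow_lt_top_of_nonneg hexp ENNReal.ofReal_ne_top)
      ENNReal.ofReal_lt_top, fun f hf => ?_⟩
  exact (setLIntegral_le_lintegral_rearr μ hEfin.ne hf).trans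
    (lintegral_rearr_le_lkNorm μ hq1 hk hkb f)
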